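/- Let (Ω, 𝓑, ℙ) be a probability space, 𝓕 ⊆ 𝓑 a sub-σ-algebra, and (X_n) a sequence of integrable random variables. Then X_n converges conditionally in distribution relative to 𝓕 to an integrable random variable X (i.e., for every A ∈ 𝓕 and interval (a,b) with ℙ(X ∈ {a,b}) = 0, ℙ(A ∩ {X_n ∈ (a,b)}) → ℙ(A)·ℙ(X ∈ (a,b))) if and only if for every t ∈ ℝ, e^{itX_n} converges to the constant 𝔼(e^{itX}) weakly in L¹ relative to 𝓕 (i.e., 𝔼(e^{itX_n}·χ_A) → 𝔼(e^{itX})·ℙ(A) for every A ∈ 𝓕). -/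

import Mathlib

open MeasureTheory Filter Set

/-- Weak convergence of probability measures on the line is convergence on the open intervals whose
endpoints are not atoms of the limit. -/
theorem tendsto_probabilityMeasure_real_iff_Ioo
    {μ : ℕ → ProbabilityMeasure ℝ} {ν : ProbabilityMeasure ℝ} :
    Tendsto μ atTop (nhds ν) ↔ ∀ a b : ℝ, (ν : Measure ℝ) {a, b} = 0 →
      Tendsto (fun n => (μ n : Measure ℝ) (Ioo a b)) atTop (nhds ((ν : Measure ℝ) (Ioo a b))) := by
  refine ⟨fun h a b hab => ?_, fun h => ?_⟩
  · refine ProbabilityMeasure.tendsto_measure_of_null_frontier_of_tendsto' h ?_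
    rcases lt_or_ge a b with hlt | hge
    · rwa [frontier_Ioo hlt]
    · simp [Ioo_eq_empty_of_le hge]
  · have hdense : Dense {x : ℝ | (ν : Measure ℝ) {x} = 0} := by
      have hc : {x : ℝ | 0 < (ν : Measure ℝ) {x}}.Countable :=
        Measure.countable_meas_pos_of_disjoint_iUnion (fun x => measurableSet_singleton x)
          fun x y hxy => by simpa using hxy
      convert hc.dense_compl ℝ using 1
      ext x
      simp
    have hpair {a b : ℝ} (ha : (ν : Measure ℝ) {a} = 0) (hb : (ν : Measure ℝ) {b} = 0) :
        (ν : Measure ℝ) {a, b} = 0 := measure_union_null ha hb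
    refine (isPiSystem_Ioo_mem {x : ℝ | (ν : Measure ℝ) {x} = 0}
      {x : ℝ | (ν : Measure ℝ) {x} = 0}).tendsto_probabilityMeasure_of_tendsto_of_mem ?_ ?_ ?_
    · rintro s ⟨a, -, b, -, -, rfl⟩
      exact measurableSet_Ioo
    · intro u hu x hx
      obtain ⟨l, r, hxlr, hlr⟩ := mem_nhds_iff_exists_Ioo_subset.1 (hu.mem_nhds hx)
      obtain ⟨a, ha, hla, hax⟩ := hdense.exists_between hxlr.1
      obtain ⟨b, hb, hxb, hbr⟩ := hdense.exists_between hxlr.2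
      exact ⟨Ioo a b, ⟨a, ha, b, hb, hax.trans hxb, rfl⟩, Ioo_mem_nhds hax hxb,
        (Ioo_subset_Ioo hla.le hbr.le).trans hlr⟩
    · rintro s ⟨a, ha, b, hb, -, rfl⟩
      rw [← ENNReal.tendsto_coe]
      simpa using h a b (hpair ha hb)

/-- The characteristic function of the law of a real random variable under a conditioned measure. -/
theorem charFun_map_cond {Ω : Type*} {mΩ : MeasurableSpace Ω} {P : Measure Ω}
    {A : Set Ω} {Y : Ω → ℝ} (hY : AEMeasurable Y P) (t : ℝ) :
    charFun ((ProbabilityTheory.cond P A).map Y) t =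
      ((P A).toReal : ℂ)⁻¹ * ∫ ω in A, Complex.exp (Complex.I * (t : ℂ) * (Y ω : ℂ)) ∂P := by
  rw [charFun_apply_real, integral_map
    (hY.mono_ac ProbabilityTheory.cond_absolutelyContinuous) (by fun_prop),
    ProbabilityTheory.cond, integral_smul_measure]
  simp only [ENNReal.toReal_inv, Complex.real_smul, Complex.ofReal_inv]
  congr 2
  funext ω
  congr 1
  ring

/-- Under conditioning on an event of positive probability, convergence on intervals and
convergence of characteristic functions are equivalent, both stated without normalization. -/
theorem tendsto_measure_inter_Ioo_iff_tendsto_setIntegral_exp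
    {Ω : Type*} {mΩ : MeasurableSpace Ω} {P : Measure Ω} [IsProbabilityMeasure P]
    {Y : ℕ → Ω → ℝ} {X : Ω → ℝ} (hY : ∀ n, AEMeasurable (Y n) P) (hX : AEMeasurable X P)
    {A : Set Ω} (hA : MeasurableSet A) (hA0 : P A ≠ 0) :
    (∀ a b : ℝ, P {ω | X ω ∈ ({a, b} : Set ℝ)} = 0 →
        Tendsto (fun n => P (A ∩ {ω | Y n ω ∈ Ioo a b})) atTop
          (nhds (P A * P {ω | X ω ∈ Ioo a b})))
    ↔ ∀ t : ℝ,
        Tendsto (fun n => ∫ ω in A, Complex.exp (Complex.I * (t : ℂ) * (Y n ω : ℂ)) ∂P) atTop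
          (nhds ((∫ ω, Complex.exp (Complex.I * (t : ℂ) * (X ω : ℂ)) ∂P)
            * ((P A).toReal : ℂ))) := by
  have hAtop : P A ≠ ⊤ := measure_ne_top P A
  have hAc : ((P A).toReal : ℂ) ≠ 0 := by
    simpa using (ENNReal.toReal_pos hA0 hAtop).ne'
  have := ProbabilityTheory.cond_isProbabilityMeasure hA0
  have hYA n : AEMeasurable (Y n) (ProbabilityTheory.cond P A) :=
    (hY n).mono_ac ProbabilityTheory.cond_absolutelyContinuous
  let μ : ℕ → ProbabilityMeasure ℝ := fun n =>
    ⟨(ProbabilityTheory.cond P A).map (Y n), Measure.isProbabilityMeasure_map (hYA n)⟩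
  let ν : ProbabilityMeasure ℝ := ⟨P.map X, Measure.isProbabilityMeasure_map hX⟩
  have hν {s : Set ℝ} (hs : MeasurableSet s) : (ν : Measure ℝ) s = P {ω | X ω ∈ s} :=
    Measure.map_apply_of_aemeasurable hX hs
  have hμ n (a b : ℝ) :
      (μ n : Measure ℝ) (Ioo a b) = (P A)⁻¹ * P (A ∩ {ω | Y n ω ∈ Ioo a b}) := by
    refine (Measure.map_apply_of_aemeasurable (hYA n) measurableSet_Ioo).trans ?_
    exact ProbabilityTheory.cond_apply hA P _
  have hνchar t : charFun (ν : Measure ℝ) t =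
      ∫ ω, Complex.exp (Complex.I * (t : ℂ) * (X ω : ℂ)) ∂P := by
    simpa [ν] using charFun_map_cond (A := univ) hX t
  have hμchar n t : charFun (μ n : Measure ℝ) t = ((P A).toReal : ℂ)⁻¹ *
      ∫ ω in A, Complex.exp (Complex.I * (t : ℂ) * (Y n ω : ℂ)) ∂P := charFun_map_cond (hY n) t
  have key := (tendsto_probabilityMeasure_real_iff_Ioo (μ := μ) (ν := ν)).symm.trans
    ProbabilityMeasure.tendsto_iff_tendsto_charFun
  convert key using 1
  · refine forall₂_congr fun a b => ?_
    rw [hν ((finite_singleton b).insert a).measurableSet, hν measurableSet_Ioo]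
    refine imp_congr_right fun _ => ⟨fun h => ?_, fun h => ?_⟩
    · simpa [hμ, ← mul_assoc, ENNReal.inv_mul_cancel hA0 hAtop] using
        ENNReal.Tendsto.const_mul h (Or.inr (ENNReal.inv_ne_top.2 hA0))
    · simpa [hμ, ← mul_assoc, ENNReal.mul_inv_cancel hA0 hAtop] using
        ENNReal.Tendsto.const_mul h (Or.inr hAtop)
  · refine forall_congr' fun t => ?_
    simp only [hνchar, hμchar]
    refine ⟨fun h => ?_, fun h => ?_⟩
    · simpa [mul_comm, hAc] using h.const_mul ((P A).toReal : ℂ)⁻¹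
    · rw [mul_comm (∫ ω, _ ∂P)]
      simpa only [mul_inv_cancel_left₀ hAc] using h.const_mul ((P A).toReal : ℂ)

/-- **Lemma (lemma:tech2).** Let `𝓕` be a sub-σ-algebra of `𝓑`. A sequence of
integrable random variables `Xn` converges conditionally in distribution relative to
`𝓕` to an integrable random variable `X` if and only if, for every `t : ℝ`, the
random variables `exp(i t Xn)` converge weakly in `L¹` relative to `𝓕` to the constant
`E(exp(i t X))`. -/
theorem conditional_convergence_iff_weakL1_relative
    {Ω : Type*} [mΩ : MeasurableSpace Ω] (P : Measure Ω) [IsProbabilityMeasure P]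
    (F : MeasurableSpace Ω) (hF : F ≤ mΩ)
    (Xn : ℕ → Ω → ℝ) (X : Ω → ℝ)
    (hXn : ∀ n, Integrable (Xn n) P) (hX : Integrable X P) :
    (∀ A : Set Ω, MeasurableSet[F] A → ∀ a b : ℝ, P {ω | X ω ∈ ({a, b} : Set ℝ)} = 0 →
        Tendsto (fun n => P (A ∩ {ω | Xn n ω ∈ Ioo a b})) atTop
          (nhds (P A * P {ω | X ω ∈ Ioo a b})))
    ↔ (∀ t : ℝ, ∀ A : Set Ω, MeasurableSet[F] A →
        Tendsto (fun n => ∫ ω in A, Complex.exp (Complex.I * (t : ℂ) * (Xn n ω : ℂ)) ∂P)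
          atTop
          (nhds ((∫ ω, Complex.exp (Complex.I * (t : ℂ) * (X ω : ℂ)) ∂P)
            * ((P A).toReal : ℂ)))) := by
  have key {A : Set Ω} (hA : MeasurableSet[F] A) (hA0 : P A ≠ 0) :=
    tendsto_measure_inter_Ioo_iff_tendsto_setIntegral_exp (fun n => (hXn n).aemeasurable)
      hX.aemeasurable (hF A hA) hA0
  refine ⟨fun h t A hA => ?_, fun h A hA => ?_⟩
  · by_cases hA0 : P A = 0
    · simp [hA0, Measure.restrict_eq_zero.2 hA0]
    · exact (key hA hA0).1 (h A hA) t
  · by_cases hA0 : P A = 0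
    · intro a b _
      simp [hA0, measure_inter_null_of_null_left]
    · exact (key hA hA0).2 fun t => h t A hA
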